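/- arXiv:1106.0420 — 3 statements merged into one kernel-verified Lean document; each statement's English description precedes it below -/
import Mathlib

section
/- Every simple graph G on 12 vertices with minimum degree at least 5 that does not contain K_{5,7} as a subgraph has a perfect matching. -/
theorem aux_mul_le {W : Type} [Fintype W] (H : SimpleGraph W) (m : ℕ)
    (h : ∀ c ∈ H.oddComponents, m ≤ c.supp.ncard) :
    H.oddComponents.ncard * m ≤ Fintype.card W := by
  classical
  have h1 : Fintype.card W =
      ∑ c : H.ConnectedComponent, (Finset.univ.filter (fun v => H.connectedComponentMk v = c)).card := by
    rw [← Finset.card_univ]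
    exact Finset.card_eq_sum_card_fiberwise (fun _ _ => Finset.mem_coe.2 (Finset.mem_univ _))
  have h2 : ∀ c : H.ConnectedComponent,
      (Finset.univ.filter (fun v => H.connectedComponentMk v = c)).card = c.supp.ncard := by
    intro c
    rw [← Set.ncard_coe_finset]
    congr 1
    ext v
    simp
  rw [h1, Set.ncard_eq_toFinset_card', ← smul_eq_mul]
  refine le_trans (Finset.card_nsmul_le_sum _ (fun c => c.supp.ncard) m ?_) ?_
  · intro c hc
    exact h c (by simpa using hc)
  · rw [Finset.sum_congr rfl (fun c _ => h2 c)]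
    exact Finset.sum_le_sum_of_subset (Finset.subset_univ _)

/-- Every simple graph on 12 vertices with minimum degree at least 5 that does not
contain `K_{5,7}` as a subgraph has a perfect matching. -/
theorem stmt_0 (V : Type) [Fintype V] [DecidableEq V] (hV : Fintype.card V = 12)
    (G : SimpleGraph V) [DecidableRel G.Adj]
    (hdeg : ∀ v : V, 5 ≤ G.degree v)
    (hK57 : ¬ ∃ (A B : Finset V), Disjoint A B ∧ A.card = 5 ∧ B.card = 7 ∧
      ∀ a ∈ A, ∀ b ∈ B, G.Adj a b) :
    ∃ M : SimpleGraph.Subgraph G, M.IsPerfectMatching := by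
  classical
  rw [SimpleGraph.tutte]
  intro u hu
  unfold SimpleGraph.IsTutteViolator at hu
  obtain ⟨S, rfl⟩ : ∃ S : Finset V, (S : Set V) = u := ⟨u.toFinset, by simp⟩
  rw [Set.ncard_coe_finset] at hu
  set D := (⊤ : G.Subgraph).deleteVerts (S : Set V) with hD
  have hmem : ∀ v, v ∈ D.verts ↔ v ∉ S := by intro v; simp [hD]
  have hadj : ∀ x y : D.verts, D.coe.Adj x y ↔ G.Adj x y := by
    intro x y
    have hx := (hmem x).1 x.2
    have hy := (hmem y).1 y.2
    simp [hD, hx, hy]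
  have hcW : Fintype.card D.verts = Sᶜ.card :=
    Fintype.card_of_subtype _ (fun v => by rw [hmem]; simp)
  have hcW' : Fintype.card D.verts + S.card = 12 := by
    rw [hcW, ← hV, add_comm]; exact Finset.card_add_card_compl S
  have hpar := SimpleGraph.odd_ncard_oddComponents D.coe
  rw [Nat.card_eq_fintype_card] at hpar
  have hsize : ∀ c : D.coe.ConnectedComponent, 6 ≤ c.supp.ncard + S.card := by
    intro c
    induction c using SimpleGraph.ConnectedComponent.ind with | _ v
    have hsub : insert (v : V) (G.neighborFinset v) ⊆
        (D.coe.connectedComponentMk v).supp.toFinset.map (Function.Embedding.subtype _) ∪ S := by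
      intro w hw
      rw [Finset.mem_union]
      by_cases hwS : w ∈ S
      · exact Or.inr hwS
      left
      rw [Finset.mem_map]
      refine ⟨⟨w, (hmem w).2 hwS⟩, ?_, rfl⟩
      rw [Set.mem_toFinset, SimpleGraph.ConnectedComponent.mem_supp_iff,
        SimpleGraph.ConnectedComponent.eq]
      rcases Finset.mem_insert.1 hw with h | h
      · subst h; exact SimpleGraph.Reachable.refl _
      · rw [SimpleGraph.mem_neighborFinset] at h
        exact ((hadj _ _).2 h.symm).reachable
    have h1 := Finset.card_le_card hsub
    rw [Finset.card_insert_of_notMem (by simp), SimpleGraph.card_neighborFinset_eq_degree] at h1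
    have h2 := Finset.card_union_le
      ((D.coe.connectedComponentMk v).supp.toFinset.map (Function.Embedding.subtype _)) S
    rw [Finset.card_map, ← Set.ncard_eq_toFinset_card'] at h2
    have := hdeg v
    omega
  have key := aux_mul_le D.coe
  have key1 := key 1 (fun c hc => Odd.pos hc)
  have hodd : ∀ c ∈ D.coe.oddComponents, c.supp.ncard % 2 = 1 := fun c hc => Nat.odd_iff.1 hc
  rw [Nat.odd_iff, Nat.odd_iff] at hpar
  generalize hk : D.coe.oddComponents.ncard = k at *
  have hS : S.card ≤ 5 := by omega
  by_cases h5 : S.card = 5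
  · apply hK57
    refine ⟨S, Sᶜ, disjoint_compl_right, h5, by omega, ?_⟩
    have hkc : k ≤ Nat.card D.coe.ConnectedComponent := by
      rw [← hk]; exact Set.ncard_le_card _
    have hbij : Function.Bijective D.coe.connectedComponentMk := by
      rw [Fintype.bijective_iff_surjective_and_card]
      have hs : Function.Surjective D.coe.connectedComponentMk := Quot.mk_surjective
      refine ⟨hs, ?_⟩
      have := Fintype.card_le_of_surjective _ hs
      rw [Nat.card_eq_fintype_card] at hkc
      omega
    intro a ha b hb
    have hbS : b ∉ S := Finset.mem_compl.1 hb
    have hsub : G.neighborFinset b ⊆ S := by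
      intro w hw
      by_contra hwS
      rw [SimpleGraph.mem_neighborFinset] at hw
      have : D.coe.Adj ⟨b, (hmem b).2 hbS⟩ ⟨w, (hmem w).2 hwS⟩ := (hadj _ _).2 hw
      exact this.ne (hbij.1 (SimpleGraph.ConnectedComponent.eq.2 this.reachable))
    have heq := Finset.eq_of_subset_of_card_le hsub (by
      rw [SimpleGraph.card_neighborFinset_eq_degree, h5]; exact hdeg b)
    rw [← heq, SimpleGraph.mem_neighborFinset] at ha
    exact ha.symm
  · have key3 : k * 3 ≤ Fintype.card D.verts := key 3 (fun c hc => by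
      have := hsize c; have := hodd c hc; omega)
    have hS1 : S.card ≤ 1 := by omega
    have key5 : k * 5 ≤ Fintype.card D.verts := key 5 (fun c hc => by
      have := hsize c; have := hodd c hc; omega)
    have hS0 : S.card = 0 := by omega
    have key7 : k * 7 ≤ Fintype.card D.verts := key 7 (fun c hc => by
      have := hsize c; have := hodd c hc; omega)
    omega
end

section
/- Let G be a simple graph on 12 vertices with minimum degree at least 5, and let S be a set of vertices of G such that the number of connected components of G − S with an odd number of vertices is strictly greater than |S|. Then |S| = 5 and every connected component of G − S consists of a single vertex; in particular, G contains K_{5,7} as a subgraph. -/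
theorem stmt_2_aux {V : Type} [Fintype V] [DecidableEq V]
    (G : SimpleGraph V) [DecidableRel G.Adj] (S : Finset V)
    (x : ((↑S : Set V)ᶜ : Set V)) :
    G.neighborFinset x ⊆ S ∪
      (((G.induce ((↑S : Set V)ᶜ)).connectedComponentMk x).supp.toFinite.toFinset.image
        Subtype.val).erase x := by
  intro w hw
  rw [SimpleGraph.mem_neighborFinset] at hw
  by_cases hS : w ∈ S
  · exact Finset.mem_union_left _ hS
  · apply Finset.mem_union_right
    rw [Finset.mem_erase]
    refine ⟨hw.ne', ?_⟩
    rw [Finset.mem_image]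
    refine ⟨⟨w, by simpa using hS⟩, ?_, rfl⟩
    rw [Set.Finite.mem_toFinset, SimpleGraph.ConnectedComponent.mem_supp_iff,
      SimpleGraph.ConnectedComponent.eq]
    apply SimpleGraph.Adj.reachable
    simpa using hw.symm

theorem stmt_2_deg {V : Type} [Fintype V] [DecidableEq V]
    (G : SimpleGraph V) [DecidableRel G.Adj] (S : Finset V)
    (x : ((↑S : Set V)ᶜ : Set V)) :
    G.degree x + 1 ≤ S.card +
      Nat.card ((G.induce ((↑S : Set V)ᶜ)).connectedComponentMk x).supp := by
  have h := Finset.card_le_card (stmt_2_aux G S x)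
  have h2 := h.trans (Finset.card_union_le _ _)
  rw [SimpleGraph.card_neighborFinset_eq_degree] at h2
  have hx : (x : V) ∈ ((G.induce ((↑S : Set V)ᶜ)).connectedComponentMk x).supp.toFinite.toFinset.image
        Subtype.val := by
    rw [Finset.mem_image]
    exact ⟨x, by simp, rfl⟩
  have h3 := Finset.card_erase_add_one hx
  rw [Finset.card_image_of_injective _ Subtype.val_injective] at h3
  rw [Nat.card_coe_set_eq, Set.ncard_eq_toFinset_card _ (Set.toFinite _)]
  omega

/-- Let `G` be a simple graph on 12 vertices with minimum degree at least 5, and let `S`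
be a vertex set such that `G - S` has more odd components than `|S|`. Then `|S| = 5`,
every component of `G - S` is a single vertex, and `G` contains `K_{5,7}` as a subgraph. -/
theorem stmt_2 (V : Type) [Fintype V] [DecidableEq V] (hV : Fintype.card V = 12)
    (G : SimpleGraph V) [DecidableRel G.Adj]
    (hdeg : ∀ v : V, 5 ≤ G.degree v)
    (S : Finset V)
    (hodd : S.card <
      Nat.card {c : (G.induce ((↑S : Set V)ᶜ)).ConnectedComponent //
        Odd (Nat.card c.supp)}) :
    S.card = 5 ∧
    (∀ c : (G.induce ((↑S : Set V)ᶜ)).ConnectedComponent, Nat.card c.supp = 1) ∧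
    (∃ (A B : Finset V), Disjoint A B ∧ A.card = 5 ∧ B.card = 7 ∧
      ∀ a ∈ A, ∀ b ∈ B, G.Adj a b) := by
  classical
  have hcardle : S.card ≤ 12 := hV ▸ Finset.card_le_univ S
  have hc : Nat.card ((↑S : Set V)ᶜ : Set V) = 12 - S.card := by
    rw [Nat.card_coe_set_eq, ← Finset.coe_compl, Set.ncard_coe_finset, Finset.card_compl, hV]
  set H := G.induce ((↑S : Set V)ᶜ) with hH
  have : Fintype H.ConnectedComponent := Fintype.ofFinite _
  have hsum : ∑ c : H.ConnectedComponent, Nat.card c.supp = 12 - S.card := by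
    rw [← hc, ← Nat.card_sigma]
    exact Nat.card_congr (Equiv.sigmaFiberEquiv H.connectedComponentMk)
  have hlow : ∀ c : H.ConnectedComponent, 6 ≤ S.card + Nat.card c.supp := by
    intro c
    induction c using SimpleGraph.ConnectedComponent.ind with
    | _ x =>
      have := stmt_2_deg G S x
      rw [← hH] at this
      have := hdeg x
      omega
  have hpos : ∀ c : H.ConnectedComponent, 1 ≤ Nat.card c.supp := by
    intro c
    have : Nonempty c.supp := c.nonempty_supp.to_subtype
    exact Nat.card_pos
  set q := Nat.card {c : H.ConnectedComponent // Odd (Nat.card c.supp)} with hq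
  have hpar : Odd q ↔ Odd (12 - S.card) := by
    rw [← hc, ← SimpleGraph.odd_ncard_oddComponents H]
    rfl
  have hq2 : S.card + 2 ≤ q := by
    rw [Nat.odd_iff, Nat.odd_iff] at hpar
    omega
  have hqf : q = (Finset.univ.filter fun c : H.ConnectedComponent => Odd (Nat.card c.supp)).card := by
    rw [hq, Nat.card_eq_fintype_card, Fintype.card_subtype]
  have hbound : ∀ k, (∀ c : H.ConnectedComponent, Odd (Nat.card c.supp) → k ≤ Nat.card c.supp) →
      q * k ≤ 12 - S.card := by
    intro k hk
    rw [← hsum, hqf, ← smul_eq_mul]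
    refine (Finset.card_nsmul_le_sum _ _ k fun c hc => hk c (Finset.mem_filter.1 hc).2).trans ?_
    exact Finset.sum_le_sum_of_subset (Finset.filter_subset _ _)
  have hb1 := hbound 1 fun c _ => hpos c
  have hb2 := hbound (6 - S.card) fun c _ => by have := hlow c; omega
  have h5 : S.card = 5 := by
    have h6 : S.card ≤ 5 := by omega
    generalize S.card = s at *
    interval_cases s
    · have := hbound 7 fun c ho => by
        have := hlow c
        rw [Nat.odd_iff] at ho
        omega
      omega
    all_goals omega
  have hone : ∀ c : H.ConnectedComponent, Nat.card c.supp = 1 := by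
    have hle : q ≤ Fintype.card H.ConnectedComponent := by
      rw [hqf]; exact Finset.card_le_univ _
    have h1 : ∑ c : H.ConnectedComponent, 1 = ∑ c : H.ConnectedComponent, Nat.card c.supp := by
      apply le_antisymm
      · exact Finset.sum_le_sum fun c _ => hpos c
      · rw [hsum]; simp; omega
    intro c
    exact ((Finset.sum_eq_sum_iff_of_le fun c _ => hpos c).1 h1 c (Finset.mem_univ _)).symm
  refine ⟨h5, hone, S, Sᶜ, disjoint_compl_right, h5, by rw [Finset.card_compl, hV, h5], ?_⟩
  intro a ha b hb
  have hb' : b ∈ ((↑S : Set V)ᶜ : Set V) := by simpa using hb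
  have hsub : G.neighborFinset b ⊆ S := by
    intro w hw
    have hw2 := stmt_2_aux G S ⟨b, hb'⟩ hw
    rw [Finset.mem_union] at hw2
    rcases hw2 with h | h
    · exact h
    · exfalso
      rw [Finset.mem_erase, Finset.mem_image] at h
      obtain ⟨hne, y, hy, rfl⟩ := h
      rw [Set.Finite.mem_toFinset] at hy
      have h1 := hone (H.connectedComponentMk ⟨b, hb'⟩)
      rw [Nat.card_coe_set_eq, Set.ncard_eq_one] at h1
      obtain ⟨z, hz⟩ := h1
      have hbz : (⟨b, hb'⟩ : ((↑S : Set V)ᶜ : Set V)) ∈ (H.connectedComponentMk ⟨b, hb'⟩).supp := rfl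
      rw [hz] at hbz hy
      exact hne (congrArg Subtype.val (hy.trans hbz.symm))
  have heq : G.neighborFinset b = S :=
    Finset.eq_of_subset_of_card_le hsub (by
      rw [h5, SimpleGraph.card_neighborFinset_eq_degree]; exact hdeg b)
  rw [← heq, SimpleGraph.mem_neighborFinset] at ha
  exact ha.symm
end

section
/- Let V be a set of 12 elements, let W ≥ 0 be a real number, and let w : V × V → ℝ be a symmetric, nonnegative function satisfying the triangle inequality (w(x,z) ≤ w(x,y) + w(y,z) for all x, y, z ∈ V). Suppose that for every v ∈ V there are at least 5 elements u ∈ V with u ≠ v and w(v,u) ≤ W. Then V can be partitioned into 6 unordered pairs {x₁,y₁}, …, {x₆,y₆} such that the total weight w(x₁,y₁) + ⋯ + w(x₆,y₆) is at most 7W. -/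
theorem stmt_4_aux {ι : Type} [Fintype ι] [DecidableEq ι] (F F' : ι → ℕ) (i j : ι) (hij : i ≠ j)
    (h : ∀ k, k ≠ i → k ≠ j → F' k = F k) (hs : ∑ k, F' k ≤ ∑ k, F k) :
    F' i + F' j ≤ F i + F j := by
  have hj : j ∈ (Finset.univ : Finset ι).erase i := by simp [hij.symm]
  rw [← Finset.add_sum_erase _ F (Finset.mem_univ i), ← Finset.add_sum_erase _ F hj,
    ← Finset.add_sum_erase _ F' (Finset.mem_univ i), ← Finset.add_sum_erase _ F' hj] at hs
  have : ∑ k ∈ (Finset.univ.erase i).erase j, F' k = ∑ k ∈ (Finset.univ.erase i).erase j, F k := by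
    apply Finset.sum_congr rfl
    intro k hk
    simp at hk
    exact h k hk.2 hk.1
  omega

/-- Let `V` be a 12-element set, `W ≥ 0`, and `w` a symmetric nonnegative function on
`V × V` satisfying the triangle inequality. If every `v ∈ V` has at least 5 elements
`u ≠ v` with `w v u ≤ W`, then `V` can be partitioned into 6 pairs of total weight
at most `7 * W`. -/
theorem stmt_4 (V : Type) [Fintype V] (hV : Fintype.card V = 12)
    (W : ℝ) (hW : 0 ≤ W) (w : V → V → ℝ)
    (hsymm : ∀ x y : V, w x y = w y x)
    (hnonneg : ∀ x y : V, 0 ≤ w x y)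
    (htri : ∀ x y z : V, w x z ≤ w x y + w y z)
    (hdeg : ∀ v : V, 5 ≤ Nat.card {u : V // u ≠ v ∧ w v u ≤ W}) :
    ∃ (x y : Fin 6 → V),
      Function.Bijective (fun p : Fin 6 × Bool => if p.2 then x p.1 else y p.1) ∧
      ∑ i : Fin 6, w (x i) (y i) ≤ 7 * W := by
  classical
  let g : V → V → ℕ := fun v u => if u ≠ v ∧ w v u ≤ W then 1 else 0
  have g1 : ∀ v u, g v u ≤ 1 := by intro v u; simp only [g]; split_ifs <;> omega
  have gself : ∀ v, g v v = 0 := by intro v; simp [g]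
  have gsymm : ∀ v u, g v u = g u v := by
    intro v u; simp only [g, hsymm v u, ne_comm]
  have gW : ∀ v u, g v u = 1 → w v u ≤ W := by
    intro v u h; simp only [g] at h; split_ifs at h with h'; exact h'.2
  have gdeg : ∀ v, 5 ≤ ∑ u, g v u := by
    intro v
    have := hdeg v
    rw [Nat.card_eq_fintype_card, Fintype.card_subtype, Finset.card_filter] at this
    exact this
  have hne : Nonempty (Fin 6 × Bool ≃ V) := ⟨Fintype.equivOfCardEq (by simp [hV])⟩
  obtain ⟨e, he⟩ := Finite.exists_max
    (fun e : Fin 6 × Bool ≃ V => ∑ i, g (e (i, true)) (e (i, false)))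
  have key : ∀ i j c, i ≠ j → g (e (i, true)) (e (j, c)) + g (e (i, false)) (e (j, !c)) ≤
      g (e (i, true)) (e (i, false)) + g (e (j, true)) (e (j, false)) := by
    intro i j c hij
    have h := stmt_4_aux _ _ i j hij ?_ (he ((Equiv.swap (i, false) (j, c)).trans e))
    · cases c
      · simpa [Equiv.swap_apply_def, hij, hij.symm, gsymm (e (j, true))] using h
      · simpa [Equiv.swap_apply_def, hij, hij.symm, gsymm (e (j, true))] using h
    · intro k hki hkj
      simp [Equiv.swap_apply_def, hki, hkj]
  have hdeg' : ∀ v, 5 ≤ ∑ i, (g v (e (i, true)) + g v (e (i, false))) := by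
    intro v
    have h := gdeg v
    rw [← Equiv.sum_comp e, Fintype.sum_prod_type] at h
    simpa using h
  refine ⟨fun i => e (i, true), fun i => e (i, false), ?_, ?_⟩
  · convert e.bijective using 1
    funext p
    rcases p with ⟨i, b⟩
    cases b <;> simp
  by_cases hall : ∀ i, g (e (i, true)) (e (i, false)) = 1
  · calc _ ≤ ∑ i : Fin 6, W := Finset.sum_le_sum fun i _ => gW _ _ (hall i)
      _ ≤ 7 * W := by simp; linarith
  push Not at hall
  obtain ⟨i, hi⟩ := hall
  have hi0 : g (e (i, true)) (e (i, false)) = 0 := by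
    have := g1 (e (i, true)) (e (i, false)); omega
  have hi0' : g (e (i, false)) (e (i, true)) = 0 := by rw [gsymm]; exact hi0
  have da := hdeg' (e (i, true))
  have db := hdeg' (e (i, false))
  have k1 := fun j h => key i j true h
  have k2 := fun j h => key i j false h
  simp only [hi0, Bool.not_true, Bool.not_false, zero_add] at k1 k2
  -- generic facts
  have comb : ∀ A A' B B' G : Fin 6 → ℕ, A i = 0 → A' i = 0 → B i = 0 → B' i = 0 →
      (∀ j, G j ≤ 1) →
      (∀ j, i ≠ j → A j + B' j ≤ G j) → (∀ j, i ≠ j → A' j + B j ≤ G j) →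
      5 ≤ ∑ j, (A j + A' j) → 5 ≤ ∑ j, (B j + B' j) →
      (∀ j, i ≠ j → G j = 1) ∧ ∃ j, (A j = 1 ∧ B j = 1) ∨ (A' j = 1 ∧ B' j = 1) := by
    clear * -
    intro A A' B B' G a1 a2 b1 b2 hG h1 h2 sa sb
    have hs : ∑ j ∈ Finset.univ.erase i, (A j + A' j) = ∑ j, (A j + A' j) :=
      Finset.sum_erase _ (by simp [a1, a2])
    have ht : ∑ j ∈ Finset.univ.erase i, (B j + B' j) = ∑ j, (B j + B' j) :=
      Finset.sum_erase _ (by simp [b1, b2])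
    have hle : ∀ j ∈ Finset.univ.erase i, (A j + A' j) + (B j + B' j) ≤ 2 := by
      intro j hj
      have hj : i ≠ j := by simpa [eq_comm] using hj
      have := h1 j hj; have := h2 j hj; have := hG j; omega
    have hc : ∑ j ∈ Finset.univ.erase i, 2 = 10 := by simp
    have hsum := Finset.sum_le_sum hle
    rw [Finset.sum_add_distrib, hs, ht, hc] at hsum
    have heq : ∀ j ∈ Finset.univ.erase i, (A j + A' j) + (B j + B' j) = 2 := by
      refine (Finset.sum_eq_sum_iff_of_le hle).1 ?_
      rw [Finset.sum_add_distrib, hs, ht, hc]; omega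
    refine ⟨fun j hj => ?_, ?_⟩
    · have := heq j (by simp [hj.symm])
      have := h1 j hj; have := h2 j hj; have := hG j; omega
    · by_contra hno
      push Not at hno
      have hev : 2 ∣ ∑ j ∈ Finset.univ.erase i, (A j + A' j) := by
        apply Finset.dvd_sum
        intro j hj
        have h3 := heq j hj
        have hj : i ≠ j := by simpa [eq_comm] using hj
        have := h1 j hj; have := h2 j hj; have := hG j
        have := hno j
        omega
      omega
  obtain ⟨hG, j, hj⟩ := comb (fun j => g (e (i, true)) (e (j, true)))
    (fun j => g (e (i, true)) (e (j, false))) (fun j => g (e (i, false)) (e (j, true)))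
    (fun j => g (e (i, false)) (e (j, false))) (fun j => g (e (j, true)) (e (j, false)))
    (gself _) hi0 hi0' (gself _) (fun j => g1 _ _) k1 k2 da db
  have h2W : w (e (i, true)) (e (i, false)) ≤ 2 * W := by
    have aux : ∀ z, g (e (i, true)) z = 1 ∧ g (e (i, false)) z = 1 →
        w (e (i, true)) (e (i, false)) ≤ 2 * W := by
      rintro z ⟨h1, h2⟩
      have := gW _ _ h1
      have := gW _ _ h2
      have := hsymm (e (i, false)) z
      have := htri (e (i, true)) z (e (i, false))
      linarith
    rcases hj with hj | hj
    · exact aux _ hj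
    · exact aux _ hj
  calc _ ≤ ∑ j : Fin 6, (W + if i = j then W else 0) := by
        apply Finset.sum_le_sum
        intro j _
        split_ifs with h
        · subst h; linarith
        · simpa using gW _ _ (hG j h)
    _ ≤ 7 * W := by
        rw [Finset.sum_add_distrib]; simp; linarith
end
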